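/- Identity for two nonterminating ₃F₂(1) series with an upper parameter 1: let a, b, d, e ∈ ℂ with Re(d+e−a−b−1) > 0 and Re(a−e+1) > 0, and assume none of d, e, b−e+1, b−e+2, a, b, d−a, d−b is a nonpositive integer. Then ∑_{k=0}^∞ (a)_k (b)_k (1)_k / ((d)_k (e)_k · k!) + ((1−e)/(e−b−1)) · ∑_{k=0}^∞ (d−a)_k (b)_k (1)_k / ((d)_k (b−e+2)_k · k!) = Γ(d) Γ(e) Γ(a−e+1) Γ(b−e+1) Γ(d+e−a−b−1) / (Γ(a) Γ(b) Γ(d−a) Γ(d−b)), where both series converge absolutely. -/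

import Mathlib

open Complex

/-- Pochhammer symbol `(a)_k = a (a+1) ⋯ (a+k-1)`. -/
noncomputable def poch (a : ℂ) (k : ℕ) : ℂ := ∏ i ∈ Finset.range k, (a + i)

open Filter Topology

/-- `z` is not a pole of the Gamma function. -/
def NonPole (z : ℂ) : Prop := ∀ m : ℕ, z ≠ -(m : ℂ)

theorem NonPole.add_natCast {z : ℂ} (hz : NonPole z) (n : ℕ) : NonPole (z + n) := by
  intro m hm
  apply hz (m + n)
  push_cast
  linear_combination hm

theorem NonPole.add_one {z : ℂ} (hz : NonPole z) : NonPole (z + 1) := by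
  simpa using hz.add_natCast 1

theorem NonPole.add_natCast_ne_zero {z : ℂ} (hz : NonPole z) (n : ℕ) : z + n ≠ 0 :=
  fun h => hz n (eq_neg_of_add_eq_zero_left h)

theorem NonPole.ne_zero {z : ℂ} (hz : NonPole z) : z ≠ 0 := by
  simpa using hz.add_natCast_ne_zero 0

theorem NonPole.of_re_pos {z : ℂ} (hz : 0 < z.re) : NonPole z := by
  intro m hm
  rw [hm] at hz
  simp only [neg_re, natCast_re] at hz
  have : (0 : ℝ) ≤ m := m.cast_nonneg
  linarith

theorem poch_zero (z : ℂ) : poch z 0 = 1 := by simp [poch]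

theorem poch_succ (z : ℂ) (k : ℕ) : poch z (k + 1) = poch z k * (z + k) := by
  simp [poch, Finset.prod_range_succ]

theorem poch_ne_zero {z : ℂ} (hz : NonPole z) (k : ℕ) : poch z k ≠ 0 :=
  Finset.prod_ne_zero_iff.2 fun i _ => hz.add_natCast_ne_zero i

theorem poch_one (k : ℕ) : poch 1 k = (Nat.factorial k : ℂ) := by
  induction k with
  | zero => simp [poch]
  | succ k ih => rw [poch_succ, ih, Nat.factorial_succ]; push_cast; ring

theorem mul_poch_add_one (z : ℂ) (k : ℕ) : z * poch (z + 1) k = poch z k * (z + k) := by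
  induction k with
  | zero => simp [poch]
  | succ k ih => rw [poch_succ, poch_succ, ← mul_assoc, ih]; push_cast; ring

theorem GammaSeq_eq_poch (z : ℂ) (k : ℕ) :
    GammaSeq z k = (k : ℂ) ^ z * (Nat.factorial k : ℂ) / poch z (k + 1) := rfl

theorem GammaSeq_ne_zero {z : ℂ} (hz : NonPole z) {k : ℕ} (hk : k ≠ 0) : GammaSeq z k ≠ 0 := by
  rw [GammaSeq_eq_poch]
  have h1 : (k : ℂ) ^ z ≠ 0 := by simp [cpow_eq_zero_iff, hk]
  have h2 : (Nat.factorial k : ℂ) ≠ 0 := by exact_mod_cast k.factorial_ne_zero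
  exact div_ne_zero (mul_ne_zero h1 h2) (poch_ne_zero hz _)

theorem poch_succ_eq_GammaSeq {z : ℂ} (hz : NonPole z) {k : ℕ} (hk : k ≠ 0) :
    poch z (k + 1) = (k : ℂ) ^ z * (Nat.factorial k : ℂ) / GammaSeq z k := by
  have h := GammaSeq_ne_zero hz hk
  have h' := poch_ne_zero hz (k + 1)
  rw [eq_div_iff h, GammaSeq_eq_poch]
  field_simp

/-- The summand of the series `₃F₂(p, q, 1; c, f; 1)`. -/
noncomputable def hypTerm (p q c f : ℂ) (k : ℕ) : ℂ :=
  poch p k * poch q k / (poch c k * poch f k)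

/-- The sum of the series `₃F₂(p, q, 1; c, f; 1)`. -/
noncomputable def hypSum (p q c f : ℂ) : ℂ := ∑' k, hypTerm p q c f k

theorem hypTerm_succ_eq {p q c f : ℂ} (hp : NonPole p) (hq : NonPole q) (hc : NonPole c)
    (hf : NonPole f) {k : ℕ} (hk : k ≠ 0) :
    hypTerm p q c f (k + 1) = (k : ℂ) ^ (p + q - c - f) *
      (GammaSeq c k * GammaSeq f k / (GammaSeq p k * GammaSeq q k)) := by
  have hk' : (k : ℂ) ≠ 0 := by exact_mod_cast hk
  have h2 : (Nat.factorial k : ℂ) ≠ 0 := by exact_mod_cast k.factorial_ne_zero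
  have h3 : ∀ z : ℂ, (k : ℂ) ^ z ≠ 0 := fun z => by simp [cpow_eq_zero_iff, hk]
  have := h3 c
  have := h3 f
  have := GammaSeq_ne_zero hp hk
  have := GammaSeq_ne_zero hq hk
  have := GammaSeq_ne_zero hc hk
  have := GammaSeq_ne_zero hf hk
  rw [hypTerm, poch_succ_eq_GammaSeq hp hk, poch_succ_eq_GammaSeq hq hk,
    poch_succ_eq_GammaSeq hc hk, poch_succ_eq_GammaSeq hf hk, cpow_sub _ _ hk', cpow_sub _ _ hk',
    cpow_add _ _ hk']
  field_simp

theorem exists_norm_hypTerm_succ_le {p q c f : ℂ} (hp : NonPole p) (hq : NonPole q)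
    (hc : NonPole c) (hf : NonPole f) :
    ∃ C : ℝ, ∀ k : ℕ, k ≠ 0 →
      ‖hypTerm p q c f (k + 1)‖ ≤ C * (k : ℝ) ^ (-(c + f - p - q - 1).re - 1) := by
  have hlim : Tendsto (fun k : ℕ => GammaSeq c k * GammaSeq f k / (GammaSeq p k * GammaSeq q k))
      atTop (𝓝 (Gamma c * Gamma f / (Gamma p * Gamma q))) :=
    ((GammaSeq_tendsto_Gamma c).mul (GammaSeq_tendsto_Gamma f)).div
      ((GammaSeq_tendsto_Gamma p).mul (GammaSeq_tendsto_Gamma q))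
      (mul_ne_zero (Gamma_ne_zero hp) (Gamma_ne_zero hq))
  obtain ⟨C, hC⟩ := hlim.norm.bddAbove_range
  refine ⟨C, fun k hk => ?_⟩
  rw [hypTerm_succ_eq hp hq hc hf hk, norm_mul, norm_natCast_cpow_of_pos (Nat.pos_of_ne_zero hk),
    mul_comm]
  have : (p + q - c - f).re = -(c + f - p - q - 1).re - 1 := by simp; ring
  rw [this]
  exact mul_le_mul_of_nonneg_right (hC ⟨k, rfl⟩) (by positivity)

theorem summable_norm_hypTerm {p q c f : ℂ} (hp : NonPole p) (hq : NonPole q)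
    (hc : NonPole c) (hf : NonPole f) (hre : 0 < (c + f - p - q - 1).re) :
    Summable fun k => ‖hypTerm p q c f k‖ := by
  obtain ⟨C, hC⟩ := exists_norm_hypTerm_succ_le hp hq hc hf
  rw [← summable_nat_add_iff 2]
  have h1 : Summable fun k : ℕ => C * (k : ℝ) ^ (-(c + f - p - q - 1).re - 1) :=
    (Real.summable_nat_rpow.2 (by linarith)).mul_left C
  exact ((summable_nat_add_iff 1).2 h1).of_nonneg_of_le (fun _ => norm_nonneg _)
    fun k => hC (k + 1) k.succ_ne_zero

theorem tendsto_mul_hypTerm {p q c f : ℂ} (hp : NonPole p) (hq : NonPole q)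
    (hc : NonPole c) (hf : NonPole f) (hre : 0 < (c + f - p - q - 1).re) :
    Tendsto (fun k : ℕ => (f + k - 1) * hypTerm p q c f k) atTop (𝓝 0) := by
  obtain ⟨C, hC⟩ := exists_norm_hypTerm_succ_le hp hq hc hf
  rw [← tendsto_add_atTop_iff_nat 1]
  have hpow : Tendsto (fun k : ℕ => (k : ℝ) ^ (-(c + f - p - q - 1).re)) atTop (𝓝 0) :=
    (tendsto_rpow_neg_atTop hre).comp tendsto_natCast_atTop_atTop
  have hbound := hpow.const_mul ((‖f‖ + 1) * C)
  rw [mul_zero] at hbound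
  refine squeeze_zero_norm' ?_ hbound
  filter_upwards [eventually_ge_atTop 1] with k hk
  have hk0 : k ≠ 0 := by omega
  have hk1 : (1 : ℝ) ≤ k := by exact_mod_cast hk
  have h1 : ‖f + ((k + 1 : ℕ) : ℂ) - 1‖ ≤ (‖f‖ + 1) * k := by
    have : f + ((k + 1 : ℕ) : ℂ) - 1 = f + (k : ℂ) := by push_cast; ring
    rw [this]
    refine (norm_add_le _ _).trans ?_
    rw [norm_natCast]
    nlinarith [norm_nonneg f]
  have h2 : (k : ℝ) ^ (-(c + f - p - q - 1).re) =
      k * (k : ℝ) ^ (-(c + f - p - q - 1).re - 1) := by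
    rw [Real.rpow_sub_one (by positivity)]
    field_simp
  rw [norm_mul, h2]
  calc _ ≤ (‖f‖ + 1) * k * (C * (k : ℝ) ^ (-(c + f - p - q - 1).re - 1)) :=
        mul_le_mul h1 (hC k hk0) (norm_nonneg _) (by positivity)
    _ = _ := by ring

theorem tsum_telescope {g : ℕ → ℂ} {l : ℂ} (hg : Tendsto g atTop (𝓝 l))
    (hs : Summable fun k => g (k + 1) - g k) : ∑' k, (g (k + 1) - g k) = l - g 0 := by
  refine tendsto_nhds_unique hs.hasSum.tendsto_sum_nat ?_
  simp_rw [Finset.sum_range_sub]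
  exact hg.sub_const _

theorem hypTerm_succ (p q c f : ℂ) (k : ℕ) :
    hypTerm p q c f (k + 1) = hypTerm p q c f k * ((p + k) * (q + k) / ((c + k) * (f + k))) := by
  simp only [hypTerm, poch_succ]
  rw [div_mul_div_comm]
  congr 1 <;> ring

theorem hypTerm_zero (p q c f : ℂ) : hypTerm p q c f 0 = 1 := by simp [hypTerm, poch_zero]

theorem hypTerm_lower_add_one (p q f : ℂ) {c : ℂ} (hc : NonPole c) (k : ℕ) :
    hypTerm p q (c + 1) f k = hypTerm p q c f k * (c / (c + k)) := by
  have h1 : poch (c + 1) k = poch c k * (c + k) / c := by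
    rw [eq_div_iff hc.ne_zero, mul_comm, mul_poch_add_one]
  simp only [hypTerm, h1]
  have := hc.ne_zero
  have := hc.add_natCast_ne_zero k
  field_simp

theorem hypTerm_upper_add_one (q c f : ℂ) {p : ℂ} (hp : NonPole p) (k : ℕ) :
    hypTerm (p + 1) q c f k = hypTerm p q c f k * ((p + k) / p) := by
  have h1 : poch (p + 1) k = poch p k * (p + k) / p := by
    rw [eq_div_iff hp.ne_zero, mul_comm, mul_poch_add_one]
  simp only [hypTerm, h1]
  ring

theorem hypSum_lower_add_one {p q c f : ℂ} (hp : NonPole p) (hq : NonPole q)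
    (hc : NonPole c) (hf : NonPole f) (hre : 0 < (c + f - p - q - 1).re) :
    c * (c + f - p - q - 1) * hypSum p q c f - (c - p) * (c - q) * hypSum p q (c + 1) f =
      c * (f - 1) := by
  have hs1 := (summable_norm_hypTerm hp hq hc hf hre).of_norm
  have hs2 := (summable_norm_hypTerm hp hq hc.add_one hf
    (by simp at hre ⊢; linarith)).of_norm
  have key : ∀ k : ℕ, c * (c + f - p - q - 1) * hypTerm p q c f k -
      (c - p) * (c - q) * hypTerm p q (c + 1) f k =
      -c * ((f + ((k + 1 : ℕ) : ℂ) - 1) * hypTerm p q c f (k + 1)) -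
        -c * ((f + k - 1) * hypTerm p q c f k) := by
    intro k
    have := hc.add_natCast_ne_zero k
    have := hf.add_natCast_ne_zero k
    rw [hypTerm_succ, hypTerm_lower_add_one p q f hc]
    have h3 : f + ((k + 1 : ℕ) : ℂ) - 1 = f + k := by push_cast; ring
    rw [h3]
    field_simp
    ring
  have hs := (hs1.mul_left (c * (c + f - p - q - 1))).sub (hs2.mul_left ((c - p) * (c - q)))
  have ht : ∑' k, (c * (c + f - p - q - 1) * hypTerm p q c f k -
      (c - p) * (c - q) * hypTerm p q (c + 1) f k) = _ := (hs1.mul_left _).tsum_sub (hs2.mul_left _)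
  rw [tsum_mul_left, tsum_mul_left] at ht
  rw [hypSum, hypSum, ← ht]
  simp_rw [key] at hs ⊢
  have hlim := (tendsto_mul_hypTerm hp hq hc hf hre).const_mul (-c)
  rw [tsum_telescope (g := fun k : ℕ => -c * ((f + k - 1) * hypTerm p q c f k)) hlim hs]
  simp [hypTerm_zero]

theorem hypSum_upper_lower_add_one {p q c f : ℂ} (hp : NonPole p) (hq : NonPole q)
    (hc : NonPole c) (hf : NonPole f) (hre : 0 < (c + f - p - q - 1).re) :
    c * (p + 1 - f) * hypSum p q c f - p * (c - q) * hypSum (p + 1) q (c + 1) f =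
      -c * (f - 1) := by
  have hs1 := (summable_norm_hypTerm hp hq hc hf hre).of_norm
  have hs2 := (summable_norm_hypTerm hp.add_one hq hc.add_one hf
    (by simp at hre ⊢; linarith)).of_norm
  have key : ∀ k : ℕ, c * (p + 1 - f) * hypTerm p q c f k -
      p * (c - q) * hypTerm (p + 1) q (c + 1) f k =
      c * ((f + ((k + 1 : ℕ) : ℂ) - 1) * hypTerm p q c f (k + 1)) -
        c * ((f + k - 1) * hypTerm p q c f k) := by
    intro k
    have := hc.add_natCast_ne_zero k
    have := hf.add_natCast_ne_zero k
    have := hp.ne_zero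
    rw [hypTerm_succ, hypTerm_upper_add_one _ _ _ hp, hypTerm_lower_add_one p q f hc]
    have h3 : f + ((k + 1 : ℕ) : ℂ) - 1 = f + k := by push_cast; ring
    rw [h3]
    field_simp
    ring
  have hs := (hs1.mul_left (c * (p + 1 - f))).sub (hs2.mul_left (p * (c - q)))
  have ht : ∑' k, (c * (p + 1 - f) * hypTerm p q c f k -
      p * (c - q) * hypTerm (p + 1) q (c + 1) f k) = _ :=
    (hs1.mul_left _).tsum_sub (hs2.mul_left _)
  rw [tsum_mul_left, tsum_mul_left] at ht
  rw [hypSum, hypSum, ← ht]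
  simp_rw [key] at hs ⊢
  have hlim := (tendsto_mul_hypTerm hp hq hc hf hre).const_mul c
  rw [tsum_telescope (g := fun k : ℕ => c * ((f + k - 1) * hypTerm p q c f k)) hlim hs]
  simp [hypTerm_zero]

/-- The left-hand side of the two-term relation, multiplied by `e - b - 1`. -/
noncomputable def hypPair (a b d e : ℂ) : ℂ :=
  (e - b - 1) * hypSum a b d e + (1 - e) * hypSum (d - a) b d (b - e + 2)

theorem hypPair_symm (a b d e : ℂ) : hypPair (d - a) b d (b - e + 2) = hypPair a b d e := by
  have h1 : d - (d - a) = a := by ring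
  have h2 : b - (b - e + 2) + 2 = e := by ring
  rw [hypPair, hypPair, h1, h2]
  ring

/-- The conditions on the parameters under which the two-term relation is considered. -/
structure Admissible (a b d e : ℂ) : Prop where
  re_pos : 0 < (d + e - a - b - 1).re
  re_pos' : 0 < (a - e + 1).re
  nonPole_a : NonPole a
  nonPole_b : NonPole b
  nonPole_d : NonPole d
  nonPole_e : NonPole e
  nonPole_f : NonPole (b - e + 2)
  nonPole_d_sub_a : NonPole (d - a)
  nonPole_d_sub_b : NonPole (d - b)

theorem Admissible.symm {a b d e : ℂ} (h : Admissible a b d e) :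
    Admissible (d - a) b d (b - e + 2) where
  re_pos := by convert h.re_pos' using 2; ring
  re_pos' := by convert h.re_pos using 2; ring
  nonPole_a := h.nonPole_d_sub_a
  nonPole_b := h.nonPole_b
  nonPole_d := h.nonPole_d
  nonPole_e := h.nonPole_f
  nonPole_f := by convert h.nonPole_e using 1; ring
  nonPole_d_sub_a := by convert h.nonPole_a using 1; ring
  nonPole_d_sub_b := h.nonPole_d_sub_b

theorem Admissible.d_add_one {a b d e : ℂ} (h : Admissible a b d e) :
    Admissible a b (d + 1) e where
  re_pos := by have := h.re_pos; simp at this ⊢; linarith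
  re_pos' := h.re_pos'
  nonPole_a := h.nonPole_a
  nonPole_b := h.nonPole_b
  nonPole_d := h.nonPole_d.add_one
  nonPole_e := h.nonPole_e
  nonPole_f := h.nonPole_f
  nonPole_d_sub_a := by convert h.nonPole_d_sub_a.add_one using 1; ring
  nonPole_d_sub_b := by convert h.nonPole_d_sub_b.add_one using 1; ring

theorem Admissible.a_d_add_one {a b d e : ℂ} (h : Admissible a b d e) :
    Admissible (a + 1) b (d + 1) e := by
  convert h.symm.d_add_one.symm using 1 <;> ring

theorem hypPair_d_add_one {a b d e : ℂ} (h : Admissible a b d e) :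
    d * (d + e - a - b - 1) * hypPair a b d e = (d - a) * (d - b) * hypPair a b (d + 1) e := by
  have h1 := hypSum_lower_add_one h.nonPole_a h.nonPole_b h.nonPole_d h.nonPole_e h.re_pos
  have h2 := hypSum_upper_lower_add_one h.nonPole_d_sub_a h.nonPole_b h.nonPole_d h.nonPole_f h.symm.re_pos
  have h3 : d + 1 - a = d - a + 1 := by ring
  rw [hypPair, hypPair, h3]
  linear_combination (e - b - 1) * h1 + (1 - e) * h2

theorem hypPair_a_d_add_one {a b d e : ℂ} (h : Admissible a b d e) :
    d * (a - e + 1) * hypPair a b d e = a * (d - b) * hypPair (a + 1) b (d + 1) e := by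
  have h1 := hypPair_d_add_one h.symm
  rw [hypPair_symm, ← hypPair_symm (d - a) b (d + 1)] at h1
  convert h1 using 2 <;> ring_nf

theorem Admissible.add_natCast {a b d e : ℂ} (h : Admissible a b d e) (n : ℕ) :
    Admissible (a + n) b (d + 2 * n) e := by
  induction n with
  | zero => simpa using h
  | succ n ih =>
    convert ih.d_add_one.a_d_add_one using 1 <;> push_cast <;> ring

theorem hypPair_add_natCast {a b d e : ℂ} (h : Admissible a b d e) (n : ℕ) :
    poch d (2 * n) * poch (d + e - a - b - 1) n * poch (a - e + 1) n * hypPair a b d e =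
      poch (d - a) n * poch a n * poch (d - b) (2 * n) * hypPair (a + n) b (d + 2 * n) e := by
  induction n with
  | zero => simp [poch_zero]
  | succ n ih =>
    have h1 := hypPair_d_add_one (h.add_natCast n)
    have h2 := hypPair_a_d_add_one (h.add_natCast n).d_add_one
    have h3 : a + ((n + 1 : ℕ) : ℂ) = a + n + 1 := by push_cast; ring
    have h4 : d + 2 * ((n + 1 : ℕ) : ℂ) = d + 2 * n + 1 + 1 := by push_cast; ring
    have h5 : 2 * (n + 1) = 2 * n + 1 + 1 := by ring
    rw [h3, h4, h5]
    simp only [poch_succ]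
    push_cast
    linear_combination (d + 2 * n) * (d + 2 * n + 1) * (d + e - a - b - 1 + n) *
        (a - e + 1 + n) * ih +
      poch (d - a) n * poch a n * poch (d - b) (2 * n) * (d + 2 * n + 1) * (a - e + 1 + n) * h1 +
      poch (d - a) n * poch a n * poch (d - b) (2 * n) * (d - a + n) * (d - b + 2 * n) * h2

theorem eventually_norm_div_le (p c : ℂ) {N : ℕ} (hNpos : 0 < N) :
    ∀ᶠ n : ℕ in atTop, ∀ j : ℕ,
      ‖(p + n + j) / (c + 2 * n + j)‖ ≤ (2 * N + j : ℝ) / (3 * N + j) := by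
  obtain ⟨n₀, hn₀⟩ := exists_nat_ge (3 * (‖p‖ + ‖c‖) + N + 1)
  filter_upwards [eventually_ge_atTop n₀] with n hn j
  have hn' : 3 * (‖p‖ + ‖c‖) + N + 1 ≤ (n : ℝ) := hn₀.trans (by exact_mod_cast hn)
  have hp := norm_nonneg p
  have hc := norm_nonneg c
  have hN : (0 : ℝ) ≤ N := N.cast_nonneg
  have hj : (0 : ℝ) ≤ j := j.cast_nonneg
  have h1 : ‖p + n + j‖ ≤ ‖p‖ + n + j := by
    refine (norm_add₃_le ..).trans ?_
    simp
  have h2 : 2 * n + j - ‖c‖ ≤ ‖c + 2 * n + j‖ := by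
    have h := norm_sub_norm_le (2 * (n : ℂ) + j) (-c)
    rw [norm_neg] at h
    have e1 : ‖2 * (n : ℂ) + j‖ = 2 * n + j := by
      rw [show (2 * (n : ℂ) + j) = ((2 * n + j : ℕ) : ℂ) by push_cast; ring, norm_natCast]
      push_cast; ring
    rw [e1] at h
    rwa [show 2 * (n : ℂ) + j - -c = c + 2 * n + j by ring] at h
  have h3 : 0 < 2 * n + j - ‖c‖ := by linarith
  rw [norm_div]
  refine (div_le_div₀ (by positivity) h1 h3 h2).trans ?_
  have : (0 : ℝ) < N := by exact_mod_cast hNpos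
  rw [div_le_div_iff₀ h3 (by positivity)]
  nlinarith [mul_nonneg hj (by linarith : (0 : ℝ) ≤ n - ‖p‖ - ‖c‖ - N),
    mul_nonneg hN (by linarith : (0 : ℝ) ≤ n - 3 * (‖p‖ + ‖c‖))]

theorem hypTerm_eq_prod (p q c f : ℂ) (k : ℕ) :
    hypTerm p q c f k =
      (∏ j ∈ Finset.range k, (p + j) / (c + j)) * (poch q k / poch f k) := by
  rw [Finset.prod_div_distrib, hypTerm, poch, poch, div_mul_div_comm]
  rfl

theorem tendsto_hypSum_add_natCast (p c : ℂ) {q f : ℂ} (hq : NonPole q) (hf : NonPole f) :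
    Tendsto (fun n : ℕ => hypSum (p + n) q (c + 2 * n) f) atTop
      (𝓝 (∑' k : ℕ, (1 / 2 : ℂ) ^ k * (poch q k / poch f k))) := by
  obtain ⟨N, hN⟩ := exists_nat_gt (max 0 (q.re - f.re + 1))
  have hN0 : (0 : ℝ) < N := (le_max_left _ _).trans_lt hN
  have hN1 : q.re - f.re + 1 < N := (le_max_right _ _).trans_lt hN
  have hsum : Summable fun k => ‖hypTerm (2 * N) q (3 * N) f k‖ :=
    summable_norm_hypTerm (.of_re_pos (by simpa using hN0)) hq
      (.of_re_pos (by simpa using hN0)) hf (by simp; linarith)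
  refine tendsto_tsum_of_dominated_convergence hsum (fun k => ?_) ?_
  · simp_rw [hypTerm_eq_prod]
    refine Tendsto.mul_const _ ?_
    have : (1 / 2 : ℂ) ^ k = ∏ j ∈ Finset.range k, (1 / 2 : ℂ) := by simp
    rw [this]
    refine tendsto_finsetProd _ fun j _ => ?_
    have := tendsto_add_mul_div_add_mul_atTop_nhds (p + j) (c + j) (1 : ℂ) (two_ne_zero' ℂ)
    refine this.congr fun n => ?_
    congr 1 <;> ring
  · filter_upwards [eventually_norm_div_le p c (Nat.cast_pos.1 hN0)] with n hn k
    rw [hypTerm_eq_prod, hypTerm_eq_prod, norm_mul, norm_mul, norm_prod, norm_prod]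
    refine mul_le_mul_of_nonneg_right ?_ (norm_nonneg _)
    refine Finset.prod_le_prod (fun _ _ => norm_nonneg _) fun j _ => (hn j).trans_eq ?_
    have e1 : (2 * N + j : ℂ) / (3 * N + j) = ((2 * N + j) / (3 * N + j) : ℝ) := by push_cast; rfl
    rw [e1, norm_real, Real.norm_of_nonneg (by positivity)]

/-- The limit of `hypPair (a + n) b (d + 2 * n) e` as `n → ∞`. -/
noncomputable def hypPairLim (b e : ℂ) : ℂ :=
  (e - b - 1) * ∑' k : ℕ, (1 / 2 : ℂ) ^ k * (poch b k / poch e k) +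
    (1 - e) * ∑' k : ℕ, (1 / 2 : ℂ) ^ k * (poch b k / poch (b - e + 2) k)

theorem tendsto_hypPair_add_natCast {a b d e : ℂ} (h : Admissible a b d e) :
    Tendsto (fun n : ℕ => hypPair (a + n) b (d + 2 * n) e) atTop (𝓝 (hypPairLim b e)) := by
  refine ((tendsto_hypSum_add_natCast a d h.nonPole_b h.nonPole_e).const_mul _).add
    (Tendsto.const_mul _ ?_)
  refine (tendsto_hypSum_add_natCast (d - a) d h.nonPole_b h.nonPole_f).congr fun n => ?_
  congr 1
  ring

theorem natCast_two_mul_add_one_cpow (b : ℂ) {n : ℕ} (hn : n ≠ 0) :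
    ((2 * n + 1 : ℕ) : ℂ) ^ b = (n : ℂ) ^ b * ((1 + 2 * n) / (0 + 1 * n)) ^ b := by
  have hn' : (n : ℝ) ≠ 0 := by exact_mod_cast hn
  have e1 : ((2 * n + 1 : ℕ) : ℂ) = ((n : ℝ) : ℂ) * (((1 + 2 * n) / (0 + 1 * n) : ℝ) : ℂ) := by
    rw [← ofReal_mul, ← ofReal_natCast]
    congr 1
    push_cast
    field_simp
    ring
  rw [e1, mul_cpow_ofReal_nonneg (by positivity) (by positivity)]
  push_cast
  rfl

theorem hypPair_mul_GammaSeq {a b d e : ℂ} (h : Admissible a b d e) {n : ℕ} (hn : n ≠ 0) :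
    hypPair a b d e * (((1 + 2 * n) / (0 + 1 * n)) ^ b *
        (GammaSeq (d - a) n * GammaSeq a n * GammaSeq (d - b) (2 * n + 1))) =
      hypPair (a + (n + 1 : ℕ)) b (d + 2 * (n + 1 : ℕ)) e *
        (GammaSeq d (2 * n + 1) * GammaSeq (d + e - a - b - 1) n * GammaSeq (a - e + 1) n) := by
  have hm : 2 * n + 1 ≠ 0 := by omega
  have key := hypPair_add_natCast h (n + 1)
  have hnp1 := NonPole.of_re_pos h.re_pos
  have hnp2 := NonPole.of_re_pos h.re_pos'
  have hn' : (n : ℂ) ≠ 0 := by exact_mod_cast hn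
  have hm' : ((2 * n + 1 : ℕ) : ℂ) ≠ 0 := by exact_mod_cast hm
  have hpow : ∀ z : ℂ, (n : ℂ) ^ z ≠ 0 := fun z => by simp [cpow_eq_zero_iff, hn]
  have hpow' : ∀ z : ℂ, ((2 * n + 1 : ℕ) : ℂ) ^ z ≠ 0 := fun z => by
    rw [Ne, cpow_eq_zero_iff]; tauto
  have hfn : (Nat.factorial n : ℂ) ≠ 0 := by exact_mod_cast n.factorial_ne_zero
  have hfm : (Nat.factorial (2 * n + 1) : ℂ) ≠ 0 := by
    exact_mod_cast (2 * n + 1).factorial_ne_zero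
  rw [show 2 * (n + 1) = 2 * n + 1 + 1 by ring, poch_succ_eq_GammaSeq h.nonPole_d hm,
    poch_succ_eq_GammaSeq h.nonPole_d_sub_b hm, poch_succ_eq_GammaSeq h.nonPole_a hn,
    poch_succ_eq_GammaSeq h.nonPole_d_sub_a hn, poch_succ_eq_GammaSeq hnp1 hn,
    poch_succ_eq_GammaSeq hnp2 hn] at key
  have hd : ((2 * n + 1 : ℕ) : ℂ) ^ d = ((2 * n + 1 : ℕ) : ℂ) ^ (d - b) *
      ((n : ℂ) ^ b * ((1 + 2 * n) / (0 + 1 * n)) ^ b) := by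
    rw [← natCast_two_mul_add_one_cpow b hn, ← cpow_add _ _ hm']
    congr 1; ring
  have hs : (n : ℂ) ^ (d + e - a - b - 1) * (n : ℂ) ^ (a - e + 1) * (n : ℂ) ^ b =
      (n : ℂ) ^ (d - a) * (n : ℂ) ^ a := by
    rw [← cpow_add _ _ hn', ← cpow_add _ _ hn', ← cpow_add _ _ hn']
    congr 1; ring
  rw [hd] at key
  generalize hypPair (a + (n + 1 : ℕ)) b (d + 2 * (n + 1 : ℕ)) e = Y at key ⊢
  generalize ((1 + 2 * (n : ℂ)) / (0 + 1 * n)) ^ b = ρ at key ⊢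
  have g1 := GammaSeq_ne_zero h.nonPole_d hm
  have g2 := GammaSeq_ne_zero h.nonPole_d_sub_b hm
  have g3 := GammaSeq_ne_zero h.nonPole_a hn
  have g4 := GammaSeq_ne_zero h.nonPole_d_sub_a hn
  have g5 := GammaSeq_ne_zero hnp1 hn
  have g6 := GammaSeq_ne_zero hnp2 hn
  have p1 := hpow' (d - b)
  have p2 := hpow (d - a)
  have p3 := hpow a
  generalize ((2 * n + 1 : ℕ) : ℂ) ^ (d - b) = P1 at *
  generalize (n : ℂ) ^ (d - a) = P2 at *
  generalize (n : ℂ) ^ a = P3 at *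
  generalize (n : ℂ) ^ b = P4 at *
  generalize (n : ℂ) ^ (d + e - a - b - 1) = P5 at *
  generalize (n : ℂ) ^ (a - e + 1) = P6 at *
  generalize (Nat.factorial n : ℂ) = F at *
  generalize (Nat.factorial (2 * n + 1) : ℂ) = F' at *
  generalize GammaSeq d (2 * n + 1) = G1 at *
  generalize GammaSeq (d - b) (2 * n + 1) = G2 at *
  generalize GammaSeq a n = G3 at *
  generalize GammaSeq (d - a) n = G4 at *
  generalize GammaSeq (d + e - a - b - 1) n = G5 at *
  generalize GammaSeq (a - e + 1) n = G6 at *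
  generalize hypPair a b d e = X at *
  have key' : P1 * F' * F ^ 2 * (P5 * P6 * P4) * (X * ρ) / (G1 * G5 * G6) =
      P1 * F' * F ^ 2 * (P2 * P3) * Y / (G4 * G3 * G2) := by
    convert key using 1 <;> (field_simp)
  rw [hs, div_eq_div_iff (by positivity) (by positivity)] at key'
  have hC : P1 * F' * F ^ 2 * (P2 * P3) ≠ 0 := by positivity
  refine mul_left_cancel₀ hC ?_
  linear_combination key'

theorem hypPair_mul_Gamma {a b d e : ℂ} (h : Admissible a b d e) :
    hypPair a b d e * (2 ^ b * (Gamma (d - a) * Gamma a * Gamma (d - b))) =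
      hypPairLim b e * (Gamma d * Gamma (d + e - a - b - 1) * Gamma (a - e + 1)) := by
  have hodd : Tendsto (fun n : ℕ => 2 * n + 1) atTop atTop :=
    tendsto_atTop_mono (fun n => by simp only [id]; omega) tendsto_id
  have hρ : Tendsto (fun n : ℕ => ((1 + 2 * (n : ℂ)) / (0 + 1 * n)) ^ b) atTop (𝓝 (2 ^ b)) := by
    have h1 := tendsto_add_mul_div_add_mul_atTop_nhds (1 : ℂ) 0 2 (one_ne_zero' ℂ)
    rw [div_one] at h1
    exact (continuousAt_cpow_const (by simp [slitPlane])).tendsto.comp h1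
  have hl := (hρ.mul (((GammaSeq_tendsto_Gamma (d - a)).mul (GammaSeq_tendsto_Gamma a)).mul
    ((GammaSeq_tendsto_Gamma (d - b)).comp hodd))).const_mul (hypPair a b d e)
  have hr := ((tendsto_add_atTop_iff_nat 1).2 (tendsto_hypPair_add_natCast h)).mul
    ((((GammaSeq_tendsto_Gamma d).comp hodd).mul
      (GammaSeq_tendsto_Gamma (d + e - a - b - 1))).mul (GammaSeq_tendsto_Gamma (a - e + 1)))
  refine tendsto_nhds_unique hl (hr.congr' ?_)
  filter_upwards [eventually_ne_atTop 0] with n hn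
  exact (hypPair_mul_GammaSeq h hn).symm

theorem hypSum_cancel {b c : ℂ} (hb : NonPole b) (hc : NonPole c) :
    hypSum c b (b + 2) c = b + 1 := by
  have hb2 : NonPole (b + 2) := by simpa using hb.add_natCast 2
  have h1 := hypSum_lower_add_one hb hc hc hb2 (by simp; linarith)
  have h2 : hypSum c b (b + 2) c = hypSum b c c (b + 2) := by
    simp only [hypSum, hypTerm]
    congr 1
    ext k
    ring
  rw [h2]
  refine mul_left_cancel₀ hc.ne_zero ?_
  linear_combination h1

theorem hypPairLim_mul_Gamma {b e : ℂ} (hb : NonPole b) (he : NonPole e)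
    (hf : NonPole (b - e + 2)) :
    hypPairLim b e * Gamma b = -(2 ^ b * Gamma e * Gamma (b - e + 2)) := by
  have hb2 : NonPole (b + 2) := by simpa using hb.add_natCast 2
  have e1 : b + 2 - e = b - e + 2 := by ring
  have e2 : b + 2 - b = 2 := by ring
  have e3 : b + 2 + e - e - b - 1 = 1 := by ring
  have hadm : Admissible e b (b + 2) e :=
    { re_pos := by rw [e3]; simp
      re_pos' := by simp
      nonPole_a := he
      nonPole_b := hb
      nonPole_d := hb2
      nonPole_e := he
      nonPole_f := hf
      nonPole_d_sub_a := by rwa [e1]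
      nonPole_d_sub_b := by rw [e2]; exact .of_re_pos (by simp) }
  have hval : hypPair e b (b + 2) e = -b * (b + 1) := by
    rw [hypPair, e1, hypSum_cancel hb he, hypSum_cancel hb hf]
    ring
  have h := hypPair_mul_Gamma hadm
  have hG2 : Gamma 2 = 1 := by simp
  have hGb : Gamma (b + 2) = (b + 1) * (b * Gamma b) := by
    rw [show b + 2 = b + 1 + 1 by ring, Gamma_add_one _ hb.add_one.ne_zero,
      Gamma_add_one _ hb.ne_zero]
  rw [hval, e1, e2, e3, sub_self, zero_add, Gamma_one, hG2, hGb] at h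
  refine mul_left_cancel₀ (mul_ne_zero hb.ne_zero hb.add_one.ne_zero) ?_
  linear_combination -h

/-- Identity for two nonterminating ₃F₂(1) series with an upper parameter 1. -/
theorem two_3F2_identity (a b d e : ℂ)
    (hre1 : 0 < (d + e - a - b - 1).re) (hre2 : 0 < (a - e + 1).re)
    (h : ∀ z ∈ [d, e, b - e + 1, b - e + 2, a, b, d - a, d - b],
      ∀ m : ℕ, z ≠ -(m : ℂ)) :
    (Summable fun k : ℕ =>
      ‖poch a k * poch b k * poch 1 k / (poch d k * poch e k * (Nat.factorial k : ℂ))‖) ∧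
    (Summable fun k : ℕ =>
      ‖poch (d - a) k * poch b k * poch 1 k /
        (poch d k * poch (b - e + 2) k * (Nat.factorial k : ℂ))‖) ∧
    (∑' k : ℕ, poch a k * poch b k * poch 1 k /
        (poch d k * poch e k * (Nat.factorial k : ℂ))) +
      (1 - e) / (e - b - 1) *
        (∑' k : ℕ, poch (d - a) k * poch b k * poch 1 k /
          (poch d k * poch (b - e + 2) k * (Nat.factorial k : ℂ))) =
    Complex.Gamma d * Complex.Gamma e * Complex.Gamma (a - e + 1) *
        Complex.Gamma (b - e + 1) * Complex.Gamma (d + e - a - b - 1) /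
      (Complex.Gamma a * Complex.Gamma b * Complex.Gamma (d - a) *
        Complex.Gamma (d - b)) := by
  have hd : NonPole d := h d (by simp)
  have he : NonPole e := h e (by simp)
  have hf1 : NonPole (b - e + 1) := h _ (by simp)
  have hf : NonPole (b - e + 2) := h _ (by simp)
  have ha : NonPole a := h a (by simp)
  have hb : NonPole b := h b (by simp)
  have hda : NonPole (d - a) := h _ (by simp)
  have hdb : NonPole (d - b) := h _ (by simp)
  have hadm : Admissible a b d e := ⟨hre1, hre2, ha, hb, hd, he, hf, hda, hdb⟩
  have hterm : ∀ (p q c f : ℂ) (k : ℕ),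
      poch p k * poch q k * poch 1 k / (poch c k * poch f k * (Nat.factorial k : ℂ)) =
        hypTerm p q c f k := by
    intro p q c f k
    have hk : (Nat.factorial k : ℂ) ≠ 0 := by exact_mod_cast k.factorial_ne_zero
    rw [poch_one, hypTerm, mul_div_mul_right _ _ hk]
  simp only [hterm]
  refine ⟨summable_norm_hypTerm ha hb hd he hre1,
    summable_norm_hypTerm hda hb hd hf hadm.symm.re_pos, ?_⟩
  change hypSum a b d e + (1 - e) / (e - b - 1) * hypSum (d - a) b d (b - e + 2) = _
  have h1 := hypPair_mul_Gamma hadm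
  have h2 := hypPairLim_mul_Gamma hb he hf
  rw [show b - e + 2 = b - e + 1 + 1 by ring, Gamma_add_one _ hf1.ne_zero] at h2
  have hne : e - b - 1 ≠ 0 := fun h0 => hf1.ne_zero (by linear_combination -h0)
  have h2b : (2 : ℂ) ^ b ≠ 0 := by simp [cpow_eq_zero_iff]
  have hΓ : Gamma a * Gamma b * Gamma (d - a) * Gamma (d - b) ≠ 0 :=
    mul_ne_zero (mul_ne_zero (mul_ne_zero (Gamma_ne_zero ha) (Gamma_ne_zero hb))
      (Gamma_ne_zero hda)) (Gamma_ne_zero hdb)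
  have hpair : hypSum a b d e + (1 - e) / (e - b - 1) * hypSum (d - a) b d (b - e + 2) =
      hypPair a b d e / (e - b - 1) := by
    rw [hypPair]
    field_simp
  rw [hpair, div_eq_div_iff hne hΓ]
  refine mul_left_cancel₀ h2b ?_
  linear_combination Gamma b * h1 +
    Gamma d * Gamma (d + e - a - b - 1) * Gamma (a - e + 1) * h2
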